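/- Let λ, θ ∈ ℝ with λ < θ, and let h : ℝ → ℝ be measurable with ∫_ℝ e^{2θt} h(t)² dt < ∞. Then v(t) := −∫_t^{∞} e^{−λ(t−s)} h(s) ds is well-defined for all t, locally absolutely continuous, satisfies v'(t) + λ v(t) = h(t) for a.e. t ∈ ℝ, and ∫_ℝ e^{2θt} v(t)² dt ≤ (θ−λ)^{−2} ∫_ℝ e^{2θt} h(t)² dt. Moreover v is the unique locally absolutely continuous function satisfying v' + λv = h a.e. with ∫_ℝ e^{2θt} v(t)² dt < ∞. -/

import Mathlib

open MeasureTheory Real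

section

open Set

theorem exp_mul_sub (δ t s : ℝ) : exp (δ * (t - s)) = exp (δ * t) * exp (-δ * s) := by
  rw [← exp_add]
  ring_nf

theorem integrableOn_exp_mul_sub_Ici {δ : ℝ} (hδ : 0 < δ) (t : ℝ) :
    IntegrableOn (fun s => exp (δ * (t - s))) (Ici t) := by
  rw [integrableOn_Ici_iff_integrableOn_Ioi]
  simp only [exp_mul_sub]
  exact (integrableOn_exp_mul_Ioi (neg_neg_of_pos hδ) t).const_mul (exp (δ * t))

theorem integral_exp_mul_sub_Ici {δ : ℝ} (hδ : 0 < δ) (t : ℝ) :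
    ∫ s in Ici t, exp (δ * (t - s)) = δ⁻¹ := by
  simp only [exp_mul_sub]
  rw [integral_Ici_eq_integral_Ioi, integral_const_mul,
    integral_exp_mul_Ioi (neg_neg_of_pos hδ), neg_div_neg_eq, mul_div_assoc', ← exp_add]
  simp

theorem integrableOn_exp_mul_sub_mul_Ici {δ : ℝ} (hδ : 0 < δ) {F : ℝ → ℝ} (hF : Integrable F)
    (t : ℝ) : IntegrableOn (fun s => exp (δ * (t - s)) * F s) (Ici t) := by
  refine hF.integrableOn.bdd_mul (c := 1) (by fun_prop) ?_
  filter_upwards [ae_restrict_mem measurableSet_Ici] with s hs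
  rw [norm_of_nonneg (exp_pos _).le, exp_le_one_iff]
  nlinarith [mem_Ici.mp hs]

theorem integrableOn_exp_mul_sub_mul_Ici_of_sq {δ : ℝ} (hδ : 0 < δ) {f : ℝ → ℝ}
    (hf : AEStronglyMeasurable f) (hf2 : Integrable (fun s => f s ^ 2)) (t : ℝ) :
    IntegrableOn (fun s => exp (δ * (t - s)) * f s) (Ici t) := by
  refine Integrable.mono' ((integrableOn_exp_mul_sub_Ici hδ t).add
    (integrableOn_exp_mul_sub_mul_Ici hδ hf2 t))
    ((by fun_prop : AEStronglyMeasurable (fun s => exp (δ * (t - s))) _).mul hf.restrict)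
    (.of_forall fun s => ?_)
  rw [norm_mul, norm_of_nonneg (exp_pos _).le, norm_eq_abs, Pi.add_apply]
  have : |f s| ≤ 1 + f s ^ 2 := by nlinarith [sq_abs (f s), sq_nonneg (|f s| - 1)]
  nlinarith [mul_le_mul_of_nonneg_left this (exp_pos (δ * (t - s))).le]

/-- Cauchy–Schwarz against the exponential kernel. -/
theorem sq_integral_exp_mul_sub_mul_le {δ : ℝ} (hδ : 0 < δ) {f : ℝ → ℝ}
    (hf : AEStronglyMeasurable f) (hf2 : Integrable (fun s => f s ^ 2)) (t : ℝ) :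
    (∫ s in Ici t, exp (δ * (t - s)) * f s) ^ 2 ≤
      δ⁻¹ * ∫ s in Ici t, exp (δ * (t - s)) * f s ^ 2 := by
  have h0 := integrableOn_exp_mul_sub_Ici hδ t
  have h1 := integrableOn_exp_mul_sub_mul_Ici_of_sq hδ hf hf2 t
  have h2 := integrableOn_exp_mul_sub_mul_Ici hδ hf2 t
  set A := ∫ s in Ici t, exp (δ * (t - s)) * f s with hA
  have hnn : 0 ≤ ∫ s in Ici t, exp (δ * (t - s)) * (f s - δ * A) ^ 2 :=
    integral_nonneg fun s => by positivity
  have hexp : ∫ s in Ici t, exp (δ * (t - s)) * (f s - δ * A) ^ 2 =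
      (∫ s in Ici t, exp (δ * (t - s)) * f s ^ 2) - 2 * δ * A * A + (δ * A) ^ 2 * δ⁻¹ := by
    rw [← integral_exp_mul_sub_Ici hδ t, ← integral_const_mul ((δ * A) ^ 2)]
    nth_rewrite 3 [hA]
    rw [← integral_const_mul (2 * δ * A), ← integral_sub h2 (h1.const_mul _),
      ← integral_add (by exact h2.sub (h1.const_mul _)) (h0.const_mul _)]
    congr 1 with s
    ring
  rw [hexp] at hnn
  have : (δ * A) ^ 2 * δ⁻¹ = δ * A ^ 2 := by field_simp
  rw [← div_eq_inv_mul, le_div_iff₀ hδ]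
  linarith

theorem integrable_and_integral_integral_exp_mul_sub {δ : ℝ} (hδ : 0 < δ) {F : ℝ → ℝ}
    (hF : Integrable F) :
    Integrable (fun t => ∫ s in Ici t, exp (δ * (t - s)) * F s) ∧
      ∫ t, ∫ s in Ici t, exp (δ * (t - s)) * F s = δ⁻¹ * ∫ s, F s := by
  set k : ℝ → ℝ := (Iic 0).indicator fun x => exp (δ * x) with hk
  have hki : Integrable k := (integrableOn_exp_mul_Iic hδ 0).integrable_indicator measurableSet_Iic
  have hkint : ∫ x, k x = δ⁻¹ := by
    rw [hk, integral_indicator measurableSet_Iic, integral_exp_mul_Iic hδ]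
    simp
  have hconv : (fun t => ∫ s in Ici t, exp (δ * (t - s)) * F s) =
      convolution F k (ContinuousLinearMap.mul ℝ ℝ) volume := by
    ext t
    rw [convolution_def, ← integral_indicator measurableSet_Ici]
    congr 1 with s
    by_cases hs : t ≤ s <;> simp [hk, indicator, hs, mul_comm]
  rw [hconv]
  refine ⟨hF.integrable_convolution _ hki, ?_⟩
  rw [integral_convolution _ hF hki, hkint, ContinuousLinearMap.mul_apply', mul_comm]

/-- Variation of constants for `y' + lam * y = exp (-lam * t) * g` with `g` locally integrable. -/
theorem exp_mul_primitive_eq {lam : ℝ} {g U : ℝ → ℝ}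
    (hg : ∀ a b, IntervalIntegrable g volume a b) (hU : ∀ a t, U t = U a + ∫ s in a..t, g s) (a t : ℝ) :
    exp (-lam * t) * U t = exp (-lam * a) * U a +
      ∫ s in a..t, (exp (-lam * s) * g s - lam * (exp (-lam * s) * U s)) := by
  have hexp : AbsolutelyContinuousOnInterval (fun s => exp (-lam * s)) a t :=
    ContDiffOn.absolutelyContinuousOnInterval (by fun_prop)
  have hUac : AbsolutelyContinuousOnInterval U a t := by
    have h1 := (hg a t).absolutelyContinuousOnInterval_intervalIntegral
      (c := a) (by simp)
    have h2 : AbsolutelyContinuousOnInterval (fun _ => U a) a t :=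
      ContDiffOn.absolutelyContinuousOnInterval (by fun_prop)
    rw [funext (hU a)]
    exact h2.add h1
  rw [← sub_eq_iff_eq_add', ← hexp.integral_deriv_mul_eq_sub hUac]
  refine intervalIntegral.integral_congr_ae ?_
  filter_upwards [(hg a t).ae_hasDerivAt_integral] with s hs hmem
  have hd : HasDerivAt U (g s) s := by
    have : U = fun x => U a + ∫ r in a..x, g r := funext (hU a)
    rw [this]
    exact (hs (uIoc_subset_uIcc hmem) a left_mem_uIcc).const_add _
  have he : HasDerivAt (fun s => exp (-lam * s)) (exp (-lam * s) * -lam) s := by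
    simpa using ((hasDerivAt_id s).const_mul (-lam)).exp
  rw [hd.deriv, he.deriv]
  ring

theorem eq_mul_exp_of_integral_eq {lam : ℝ} {d : ℝ → ℝ} (hc : Continuous d)
    (hd : ∀ t, d t = d 0 + ∫ s in (0 : ℝ)..t, -lam * d s) (t : ℝ) :
    d t = d 0 * exp (-lam * t) := by
  have hder (x : ℝ) : HasDerivAt d (-lam * d x) x := by
    have hcont : Continuous fun s => -lam * d s := by fun_prop
    have : d = fun t => d 0 + ∫ s in (0 : ℝ)..t, -lam * d s := funext hd
    rw [this, show -lam * (fun t => d 0 + ∫ s in (0 : ℝ)..t, -lam * d s) x = -lam * d x by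
      rw [← this]]
    exact (hcont.integral_hasStrictDerivAt 0 x).hasDerivAt.const_add _
  have hP (x : ℝ) : HasDerivAt (fun t => d t * exp (lam * t)) 0 x := by
    have he : HasDerivAt (fun t => exp (lam * t)) (exp (lam * x) * lam) x := by
      simpa using ((hasDerivAt_id x).const_mul lam).exp
    exact ((hder x).mul he).congr_deriv (by ring)
  have := is_const_of_deriv_eq_zero (fun x => (hP x).differentiableAt) (fun x => (hP x).deriv) t 0
  simp only [mul_zero, exp_zero, mul_one] at this
  rw [← this, mul_assoc, ← exp_add]
  simp

theorem continuous_of_eq_add_integral {u f : ℝ → ℝ} (hf : ∀ a b, IntervalIntegrable f volume a b)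
    (hu : ∀ t, u t = u 0 + ∫ s in (0 : ℝ)..t, f s) : Continuous u := by
  rw [funext hu]
  exact continuous_const.add
    (intervalIntegral.continuous_primitive hf 0)

theorem eq_zero_of_integrable_exp_mul_sq {δ c : ℝ} (hδ : 0 ≤ δ)
    (h : Integrable fun t => c ^ 2 * exp (δ * t)) : c = 0 := by
  have hconst : IntegrableOn (fun _ : ℝ => c ^ 2) (Ici 0) := by
    refine Integrable.mono' h.integrableOn (by fun_prop) ?_
    filter_upwards [ae_restrict_mem measurableSet_Ici] with t ht
    rw [norm_of_nonneg (sq_nonneg c)]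
    exact le_mul_of_one_le_right (sq_nonneg c) (one_le_exp (mul_nonneg hδ ht))
  rw [integrableOn_const_iff] at hconst
  simpa using hconst

end

/-- **Scalar mode solver, unstable case (`λ < θ`).** For `h` measurable with
`∫ e^{2θt} h(t)² dt < ∞`, the function `v(t) = −∫_t^∞ e^{−λ(t−s)} h(s) ds` is
well-defined, locally absolutely continuous (encoded via the integral identity
`v t = v a + ∫_a^t (h − λ v)` together with local integrability of `h − λ v`), solves
`v' + λv = h` a.e., belongs to the weighted space with
`∫ e^{2θt} v² ≤ (θ−λ)⁻² ∫ e^{2θt} h²`, and is the unique such solution. -/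
theorem stmt_8 (lam θ : ℝ) (hθ : lam < θ) (h : ℝ → ℝ) (hmeas : Measurable h)
    (hL2 : Integrable (fun t => exp (2 * θ * t) * h t ^ 2))
    (v : ℝ → ℝ) (hv : ∀ t, v t = -∫ s in Set.Ici t, exp (-(lam * (t - s))) * h s) :
    (∀ t : ℝ, IntegrableOn (fun s => exp (-(lam * (t - s))) * h s) (Set.Ici t)) ∧
    (∀ a b : ℝ, IntegrableOn (fun s => h s - lam * v s) (Set.uIcc a b)) ∧
    (∀ a t : ℝ, v t = v a + ∫ s in a..t, (h s - lam * v s)) ∧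
    Integrable (fun t => exp (2 * θ * t) * v t ^ 2) ∧
    (∫ t, exp (2 * θ * t) * v t ^ 2) ≤ ((θ - lam)⁻¹) ^ 2 * ∫ t, exp (2 * θ * t) * h t ^ 2 ∧
    (∀ w : ℝ → ℝ,
        (∀ a b : ℝ, IntegrableOn (fun s => h s - lam * w s) (Set.uIcc a b)) →
        (∀ a t : ℝ, w t = w a + ∫ s in a..t, (h s - lam * w s)) →
        Integrable (fun t => exp (2 * θ * t) * w t ^ 2) → w = v) := by
  have hδ : 0 < θ - lam := sub_pos.mpr hθ
  set f : ℝ → ℝ := fun s => exp (θ * s) * h s with hf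
  have hfm : AEStronglyMeasurable f := by
    have : Measurable f := by fun_prop
    exact this.aestronglyMeasurable
  have hsq (u : ℝ → ℝ) (t : ℝ) : exp (2 * θ * t) * u t ^ 2 = (exp (θ * t) * u t) ^ 2 := by
    rw [mul_pow, ← exp_nat_mul]
    push_cast
    ring_nf
  have hf2 : Integrable fun s => f s ^ 2 := by
    simpa only [hsq h] using hL2
  set g : ℝ → ℝ := fun s => exp (lam * s) * h s with hg
  have hweight (t s : ℝ) : exp (-(lam * (t - s))) * h s =
      exp (-(θ * t)) * (exp ((θ - lam) * (t - s)) * f s) := by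
    simp only [hf, ← mul_assoc, ← exp_add]
    ring_nf
  have hint (t : ℝ) : IntegrableOn (fun s => exp (-(lam * (t - s))) * h s) (Set.Ici t) := by
    simp only [hweight]
    exact (integrableOn_exp_mul_sub_mul_Ici_of_sq hδ hfm hf2 t).const_mul _
  have hkernel (t s : ℝ) : exp (-(lam * (t - s))) * h s = exp (-lam * t) * g s := by
    simp only [hg, ← mul_assoc, ← exp_add]
    ring_nf
  have hgint (t : ℝ) : IntegrableOn g (Set.Ici t) := by
    have := (hint t).const_mul (exp (lam * t))
    simp only [hkernel, ← mul_assoc, ← exp_add] at this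
    simp only [neg_mul, add_neg_cancel, exp_zero, one_mul] at this
    exact this
  have hgii (a b : ℝ) : IntervalIntegrable g volume a b :=
    ((hgint (min a b)).mono_set Set.Icc_subset_Ici_self).intervalIntegrable
  set U : ℝ → ℝ := fun t => -∫ s in Set.Ici t, g s with hUdef
  have hU (a t : ℝ) : U t = U a + ∫ s in a..t, g s := by
    rw [← intervalIntegral.integral_Ici_sub_Ici' (hgint a) (hgint t)]
    ring
  have hvU (t : ℝ) : v t = exp (-lam * t) * U t := by
    simp only [hv, hkernel, integral_const_mul, hUdef, mul_neg]
  have hvc : Continuous v := by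
    rw [funext hvU]
    exact (by fun_prop : Continuous fun t => exp (-lam * t)).mul
      (continuous_of_eq_add_integral hgii (hU 0))
  have hhg (s : ℝ) : h s = exp (-lam * s) * g s := by
    simp [hg, ← mul_assoc, ← exp_add]
  have hhint (a b : ℝ) : IntegrableOn h (Set.uIcc a b) := by
    rw [funext hhg]
    exact IntegrableOn.continuousOn_mul (by fun_prop)
      ((hgint (min a b)).mono_set Set.Icc_subset_Ici_self) isCompact_uIcc
  have hvint (a b : ℝ) : IntegrableOn (fun s => h s - lam * v s) (Set.uIcc a b) :=
    (hhint a b).sub ((hvc.const_mul lam).continuousOn.integrableOn_compact isCompact_uIcc)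
  have hvode (a t : ℝ) : v t = v a + ∫ s in a..t, (h s - lam * v s) := by
    simpa only [← hvU, ← hhg] using exp_mul_primitive_eq (lam := lam) hgii hU a t
  have hvf (t : ℝ) : exp (θ * t) * v t =
      -∫ s in Set.Ici t, exp ((θ - lam) * (t - s)) * f s := by
    simp only [hv, hweight, integral_const_mul]
    rw [mul_neg, ← mul_assoc, ← exp_add]
    simp
  have hbound (t : ℝ) : exp (2 * θ * t) * v t ^ 2 ≤
      (θ - lam)⁻¹ * ∫ s in Set.Ici t, exp ((θ - lam) * (t - s)) * f s ^ 2 := by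
    rw [hsq, hvf, neg_sq]
    exact sq_integral_exp_mul_sub_mul_le hδ hfm hf2 t
  obtain ⟨hKint, hKeq⟩ := integrable_and_integral_integral_exp_mul_sub hδ hf2
  have hvL2 : Integrable fun t => exp (2 * θ * t) * v t ^ 2 := by
    refine (hKint.const_mul (θ - lam)⁻¹).mono' (by fun_prop) (.of_forall fun t => ?_)
    rw [norm_of_nonneg (by positivity)]
    exact hbound t
  refine ⟨hint, hvint, hvode, hvL2, ?_, fun w hwint hwode hwL2 => ?_⟩
  · calc ∫ t, exp (2 * θ * t) * v t ^ 2
        ≤ ∫ t, (θ - lam)⁻¹ * ∫ s in Set.Ici t, exp ((θ - lam) * (t - s)) * f s ^ 2 :=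
          integral_mono hvL2 (hKint.const_mul _) hbound
      _ = ((θ - lam)⁻¹) ^ 2 * ∫ t, exp (2 * θ * t) * h t ^ 2 := by
          rw [integral_const_mul, hKeq, ← mul_assoc, ← sq]
          simp only [hsq h, hf]
  · have hwc : Continuous w :=
      continuous_of_eq_add_integral (fun a b => (hwint a b).intervalIntegrable) (hwode 0)
    set d : ℝ → ℝ := fun t => w t - v t with hd
    have hdode (t : ℝ) : d t = d 0 + ∫ s in (0 : ℝ)..t, -lam * d s := by
      have hsub : ∫ s in (0 : ℝ)..t, -lam * d s =
          (∫ s in (0 : ℝ)..t, (h s - lam * w s)) - ∫ s in (0 : ℝ)..t, (h s - lam * v s) := by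
        rw [← intervalIntegral.integral_sub (hwint 0 t).intervalIntegrable
          (hvint 0 t).intervalIntegrable]
        congr 1 with s
        ring
      rw [hsub]
      linarith [hwode 0 t, hvode 0 t]
    have hdexp : ∀ t, d t = d 0 * exp (-lam * t) :=
      eq_mul_exp_of_integral_eq (hwc.sub hvc) hdode
    have hdL2 : Integrable fun t => exp (2 * θ * t) * d t ^ 2 := by
      refine ((hwL2.add hvL2).const_mul 2).mono' (by fun_prop) (.of_forall fun t => ?_)
      rw [norm_of_nonneg (by positivity), Pi.add_apply]
      nlinarith [mul_nonneg (exp_pos (2 * θ * t)).le (sq_nonneg (w t + v t))]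
    have hd0 : d 0 = 0 := by
      refine eq_zero_of_integrable_exp_mul_sq (δ := 2 * (θ - lam)) (by positivity) ?_
      convert hdL2 using 2 with t
      rw [hsq, hdexp t, mul_left_comm, mul_pow, ← exp_add, ← exp_nat_mul]
      push_cast
      ring_nf
    ext t
    have := hdexp t
    rw [hd0, zero_mul] at this
    exact sub_eq_zero.mp this
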